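/- For n ≥ 0 or n ≤ -2 and 0 ≤ m ≤ n+1 (resp. 0 ≤ m ≤ -n-2), the vector part of X_{n,m}^{±} satisfies ‖Vec X_{n,m}^{±}‖² = 2π(n² + m² + n)(δ_{0,m}+1)(|n+3/2| + m − 1/2)! / ((2n+3)(2n+1)(|n+3/2| − m − 1/2)!), where the L² norm is over the unit ball for n ≥ 0 and over its exterior for n ≤ -2. -/

import Mathlib

open MeasureTheory Real

noncomputable section

/-- Euclidean space `ℝ³` with coordinates `x 0, x 1, x 2`. -/
abbrev E3 := EuclideanSpace ℝ (Fin 3)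

/-- Legendre polynomial of degree `n` via Rodrigues' formula. -/
def legendreP (n : ℕ) (t : ℝ) : ℝ :=
  (1 / (2 ^ n * n.factorial : ℝ)) * iteratedDeriv n (fun s : ℝ => (s ^ 2 - 1) ^ n) t

/-- Associated Legendre function of nonnegative integer degree `n` and order `m`
(Ferrers-type definition, no Condon–Shortley phase):
`P_n^m(t) = (1-t²)^{m/2} (d/dt)^m P_n(t)`. -/
def assocLegendreNat (n m : ℕ) (t : ℝ) : ℝ :=
  (1 - t ^ 2) ^ ((m : ℝ) / 2) * iteratedDeriv m (legendreP n) t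

/-- Associated Legendre function of arbitrary integer degree, using the
reflection `P_{-n}^m = P_{n-1}^m` for negative degrees. -/
def assocLegendre (n : ℤ) (m : ℕ) (t : ℝ) : ℝ :=
  if 0 ≤ n then assocLegendreNat n.toNat m t else assocLegendreNat (-n - 1).toNat m t

/-- Spherical radius `ρ`. -/
def sphRho (x : E3) : ℝ := Real.sqrt (x 0 ^ 2 + x 1 ^ 2 + x 2 ^ 2)

/-- Azimuthal angle `φ` of the point `(x₁, x₂)`. -/
def sphPhi (x : E3) : ℝ := Complex.arg ⟨x 1, x 2⟩

/-- Azimuthal factor `Φ_m^±(φ)`; `sgn = true` corresponds to `+` (cosine),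
`sgn = false` to `−` (sine). -/
def PhiFac (m : ℕ) (sgn : Bool) (φ : ℝ) : ℝ :=
  if sgn then Real.cos (m * φ) else Real.sin (m * φ)

/-- Solid spherical harmonic `U_{n,m}^{±}(x) = ρ^n P_n^m(cos θ) Φ_m^{±}(φ)`. -/
def solidU (n : ℤ) (m : ℕ) (sgn : Bool) (x : E3) : ℝ :=
  sphRho x ^ n * assocLegendre n m (x 0 / sphRho x) * PhiFac m sgn (sphPhi x)

/-- The exterior `B^e` of the closed unit ball in `ℝ³`. -/
def extB : Set E3 := {x : E3 | 1 < ‖x‖}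

/-- The quaternions; the subspace `𝒜 = ℝ + ℝe₁ + ℝe₂` consists of those
quaternions with `imK = 0`. -/
abbrev H := Quaternion ℝ

def qe1 : H := ⟨0, 1, 0, 0⟩
def qe2 : H := ⟨0, 0, 1, 0⟩

/-- Partial derivative `∂/∂xᵢ` of a quaternion-valued function. -/
def pd (i : Fin 3) (f : E3 → H) (x : E3) : H :=
  fderiv ℝ f x (EuclideanSpace.single i 1)

/-- The Cauchy–Riemann (Fueter) operator `∂̄ = ∂/∂x₀ + e₁∂/∂x₁ + e₂∂/∂x₂`. -/
def Dbar (f : E3 → H) (x : E3) : H := pd 0 f x + qe1 * pd 1 f x + qe2 * pd 2 f x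

/-- The conjugate Fueter operator `∂ = ∂/∂x₀ − e₁∂/∂x₁ − e₂∂/∂x₂`. -/
def Dop (f : E3 → H) (x : E3) : H := pd 0 f x - qe1 * pd 1 f x - qe2 * pd 2 f x

/-- The solid harmonic `U_{n,m}^±` regarded as a quaternion-valued function. -/
def solidUq (n : ℤ) (m : ℕ) (sgn : Bool) (x : E3) : H := ((solidU n m sgn x : ℝ) : H)

/-- The basic spherical monogenic `X_{n,m}^{±} = ∂U_{n+1,m}^{±}`. -/
def Xmon (n : ℤ) (m : ℕ) (sgn : Bool) : E3 → H := Dop (solidUq (n + 1) m sgn)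

/-- The scalar inner product on `𝒜`-valued quaternions:
`⟨p,q⟩ = p₀q₀ + p₁q₁ + p₂q₂`. -/
def qip (p q : H) : ℝ := p.re * q.re + p.imI * q.imI + p.imJ * q.imJ


open ENNReal in
theorem sph_step1 (F : E3 → ℝ≥0∞) :
    ∫⁻ x, F x = ∫⁻ p : ℝ × (ℝ × ℝ), F !₂[p.1, p.2.1, p.2.2] := by
  have h1 := (PiLp.volume_preserving_toLp (Fin 3))
  have h2 := (volume_preserving_piFinSuccAbove (fun _ : Fin 3 => ℝ) 0)
  have h3 : MeasurePreserving (Prod.map id (MeasurableEquiv.finTwoArrow (α := ℝ)).symm)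
      (volume : Measure (ℝ × (ℝ × ℝ))) (volume : Measure (ℝ × (Fin 2 → ℝ))) :=
    (MeasurePreserving.id (volume : Measure ℝ)).prod (volume_preserving_finTwoArrow ℝ).symm
  rw [← h1.lintegral_comp_emb (MeasurableEquiv.toLp 2 (Fin 3 → ℝ)).measurableEmbedding]
  rw [← h2.symm.lintegral_comp_emb (MeasurableEquiv.measurableEmbedding _)]
  rw [← h3.lintegral_comp_emb]
  · refine lintegral_congr fun p => ?_
    congr 1
    ext i
    fin_cases i <;> simp [MeasurableEquiv.piFinSuccAbove, MeasurableEquiv.finTwoArrow, MeasurableEquiv.piFinTwo, Fin.insertNthEquiv]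
  · exact ((MeasurableEquiv.refl ℝ).prodCongr (MeasurableEquiv.finTwoArrow (α := ℝ)).symm).measurableEmbedding

open ENNReal in
theorem sph_polar (g : ℝ × ℝ → ℝ≥0∞) (hg : Measurable g) :
    ∫⁻ p, g p = ∫⁻ r in Set.Ioi (0:ℝ), ∫⁻ θ in Set.Ioo (-π) π,
      ENNReal.ofReal r * g (r * cos θ, r * sin θ) := by
  rw [← lintegral_comp_polarCoord_symm, polarCoord_target, Measure.volume_eq_prod, ← Measure.prod_restrict,
    lintegral_prod]
  · simp [smul_eq_mul]
  · simp only [smul_eq_mul, polarCoord_symm_apply]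
    fun_prop

open ENNReal in
theorem sph_lintegral (F : E3 → ℝ≥0∞) (hF : Measurable F) :
    ∫⁻ x, F x = ∫⁻ φ in Set.Ioo (-π) π, ∫⁻ r in Set.Ioi (0:ℝ), ∫⁻ θ in Set.Ioo 0 π,
      ENNReal.ofReal (r ^ 2 * sin θ) *
        F !₂[r * cos θ, r * sin θ * cos φ, r * sin θ * sin φ] := by
  have hG : Measurable (fun p : ℝ × (ℝ × ℝ) => F !₂[p.1, p.2.1, p.2.2]) := by
    refine hF.comp ?_
    have : Continuous (fun p : ℝ × (ℝ × ℝ) => (!₂[p.1, p.2.1, p.2.2] : E3)) := by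
      refine (PiLp.continuous_toLp 2 _).comp ?_
      refine continuous_pi fun i => ?_
      fin_cases i <;> simp <;> fun_prop
    exact this.measurable
  set G : ℝ × (ℝ × ℝ) → ℝ≥0∞ := fun p => F !₂[p.1, p.2.1, p.2.2] with hGdef
  have key : ∫⁻ x, F x = ∫⁻ φ in Set.Ioo (-π) π, ∫⁻ z : ℝ, ∫⁻ s in Set.Ioi (0:ℝ),
      ENNReal.ofReal s * G (z, (s * cos φ, s * sin φ)) := by
    rw [sph_step1, Measure.volume_eq_prod, lintegral_prod _ hG.aemeasurable]
    symm
    rw [lintegral_lintegral_swap]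
    · refine lintegral_congr fun z => ?_
      rw [sph_polar _ (by fun_prop), lintegral_lintegral_swap]
      fun_prop
    · refine Measurable.aemeasurable ?_
      refine Measurable.lintegral_prod_right' (f := fun q : (ℝ × ℝ) × ℝ => ENNReal.ofReal q.2 * G (q.1.2, (q.2 * cos q.1.1, q.2 * sin q.1.1))) ?_
      fun_prop
  rw [key]
  refine lintegral_congr fun φ => ?_
  set g : ℝ × ℝ → ℝ≥0∞ := Set.indicator {p | 0 < p.2}
    (fun p => ENNReal.ofReal p.2 * G (p.1, (p.2 * cos φ, p.2 * sin φ))) with hg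
  have hgm : Measurable g := by
    refine Measurable.indicator (by fun_prop) (measurableSet_lt measurable_const measurable_snd)
  have e1 : ∫⁻ z : ℝ, ∫⁻ s in Set.Ioi (0:ℝ), ENNReal.ofReal s * G (z, (s * cos φ, s * sin φ))
      = ∫⁻ p, g p := by
    rw [Measure.volume_eq_prod, lintegral_prod _ hgm.aemeasurable]
    refine lintegral_congr fun z => ?_
    rw [← lintegral_indicator measurableSet_Ioi]
    refine lintegral_congr fun s => ?_
    by_cases hs : 0 < s <;> simp [hg, Set.indicator, hs]
  rw [e1, sph_polar _ hgm]
  refine setLIntegral_congr_fun measurableSet_Ioi fun r hr => ?_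
  have hr : 0 < r := hr
  rw [← lintegral_indicator measurableSet_Ioo, ← lintegral_indicator measurableSet_Ioo]
  refine lintegral_congr fun θ => ?_
  by_cases h1 : θ ∈ Set.Ioo 0 π
  · have hs := sin_pos_of_mem_Ioo h1
    have h2 : θ ∈ Set.Ioo (-π) π := ⟨by linarith [h1.1, pi_pos], h1.2⟩
    have h3 : 0 < r * sin θ := by positivity
    rw [Set.indicator_of_mem h1, Set.indicator_of_mem h2, hg, Set.indicator_of_mem (by exact h3)]
    rw [← mul_assoc, ← ENNReal.ofReal_mul hr.le]
    simp only [hGdef]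
    congr 2
    ring
  · rw [Set.indicator_of_notMem h1]
    by_cases h2 : θ ∈ Set.Ioo (-π) π
    · rw [Set.indicator_of_mem h2, hg, Set.indicator_of_notMem, mul_zero]
      have : sin θ ≤ 0 := by
        apply sin_nonpos_of_nonpos_of_neg_pi_le _ h2.1.le
        by_contra h; exact h1 ⟨not_le.mp h, h2.2⟩
      simp only [Set.mem_ofPred_eq, not_lt]
      nlinarith
    · rw [Set.indicator_of_notMem h2]


open Polynomial in
def legU (k : ℕ) : ℝ[X] := (X ^ 2 - 1) ^ k

open Polynomial in
def legQ (k m : ℕ) : ℝ[X] := C (1 / (2 ^ k * k.factorial : ℝ)) * derivative^[k + m] (legU k)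

open Polynomial in
theorem iteratedDeriv_poly (p : ℝ[X]) (j : ℕ) :
    iteratedDeriv j (fun t : ℝ => p.eval t) = fun t => (derivative^[j] p).eval t := by
  induction j generalizing p with
  | zero => simp
  | succ j ih =>
    rw [iteratedDeriv_succ', Function.iterate_succ_apply, ← ih]
    congr 1
    ext t
    simp

open Polynomial in
theorem legQ_deriv (k m : ℕ) : derivative (legQ k m) = legQ k (m + 1) := by
  simp only [legQ, ← add_assoc, Function.iterate_succ_apply', derivative_C_mul]

open Polynomial in
theorem legendreP_eq (k : ℕ) : legendreP k = fun t => (legQ k 0).eval t := by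
  ext t
  have : (fun s : ℝ => (s ^ 2 - 1) ^ k) = fun s => (legU k).eval s := by
    ext s; simp [legU]
  rw [legendreP, this, iteratedDeriv_poly]
  simp [legQ]

open Polynomial in
theorem iteratedDeriv_legendreP (k m : ℕ) :
    iteratedDeriv m (legendreP k) = fun t => (legQ k m).eval t := by
  rw [legendreP_eq, iteratedDeriv_poly]
  have : derivative^[m] (legQ k 0) = legQ k m := by
    induction m with
    | zero => rfl
    | succ m ih => rw [Function.iterate_succ_apply', ih, legQ_deriv]
  rw [this]

open Polynomial in
theorem legU_ode (k j : ℕ) :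
    (X ^ 2 - 1) * derivative^[j + 2] (legU k) + C (2 * ((j:ℝ) + 1 - k)) * X * derivative^[j + 1] (legU k)
      + C (((j:ℝ) + 1) * (j - 2 * k)) * derivative^[j] (legU k) = 0 := by
  induction j with
  | zero =>
    have h1 : (X ^ 2 - 1) * derivative (legU k) = C (2 * (k:ℝ)) * X * legU k := by
      unfold legU
      cases k with
      | zero => simp
      | succ k =>
        simp only [derivative_pow, derivative_sub, derivative_X_pow, derivative_one, map_mul, map_natCast]
        simp [(map_ofNat C 2 : (C 2 : ℝ[X]) = 2)]
        ring
    have h2 := congrArg derivative h1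
    simp only [derivative_mul, derivative_sub, derivative_X_pow, derivative_one, derivative_C, derivative_X] at h2
    simp only [Function.iterate_succ_apply', Function.iterate_zero_apply, zero_add]
    simp only [map_mul, map_add, map_sub, map_natCast, map_one, map_zero, map_ofNat] at h2 ⊢
    simp at h2 ⊢
    linear_combination h2
  | succ j ih =>
    have h2 := congrArg derivative ih
    simp only [derivative_mul, derivative_add, derivative_sub, derivative_X_pow, derivative_one, derivative_C, derivative_X, derivative_zero, ← Function.iterate_succ_apply' (f := (derivative : ℝ[X] → ℝ[X]))] at h2
    simp only [map_mul, map_add, map_sub, map_natCast, map_one, map_zero, map_ofNat, Nat.cast_add, Nat.cast_one, Nat.succ_eq_add_one] at h2 ⊢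
    simp at h2 ⊢
    linear_combination h2

/-- eigenvalue parameter -/
def legLam (k m : ℕ) : ℝ := ((k:ℝ) - m) * (k + m + 1)

open Polynomial in
theorem legQ_ode (k m : ℕ) :
    (1 - X ^ 2) * legQ k (m + 2) - C (2 * ((m:ℝ) + 1)) * X * legQ k (m + 1)
      + C (legLam k m) * legQ k m = 0 := by
  have h := legU_ode k (k + m)
  unfold legQ legLam
  simp only [map_mul, map_add, map_sub, map_natCast, map_one, map_zero, map_ofNat, Nat.cast_add, ← add_assoc] at h ⊢
  linear_combination (- C (1 / (2 ^ k * k.factorial : ℝ))) * h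

open Polynomial in
def legL (p : ℝ[X]) : ℝ := ∫ t in (-1:ℝ)..1, p.eval t

open Polynomial in
theorem legL_add (p q : ℝ[X]) : legL (p + q) = legL p + legL q := by
  unfold legL
  simp only [eval_add]
  exact intervalIntegral.integral_add (p.continuous.intervalIntegrable _ _) (q.continuous.intervalIntegrable _ _)

open Polynomial in
theorem legL_C_mul (c : ℝ) (q : ℝ[X]) : legL (C c * q) = c * legL q := by
  unfold legL
  simp

open Polynomial in
theorem legL_deriv (p : ℝ[X]) (h1 : p.eval 1 = 0) (h2 : p.eval (-1) = 0) :
    legL (derivative p) = 0 := by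
  unfold legL
  rw [intervalIntegral.integral_eq_sub_of_hasDerivAt (f := fun t => p.eval t)
    (fun t _ => p.hasDerivAt t) (p.derivative.continuous.intervalIntegrable _ _), h1, h2, sub_zero]

open Polynomial in
/-- `∫ w^m Q²` -/
def legA (k m : ℕ) : ℝ := legL ((1 - X ^ 2) ^ m * legQ k m ^ 2)

open Polynomial in
theorem dw (m : ℕ) : derivative ((1 - X ^ 2 : ℝ[X]) ^ (m + 1)) = - C (2 * ((m:ℝ) + 1)) * X * (1 - X ^ 2) ^ m := by
  rw [derivative_pow]
  simp [map_mul, map_add, map_natCast, (map_ofNat C 2 : (C 2 : ℝ[X]) = 2)]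
  ring

open Polynomial in
theorem legA_succ (k m : ℕ) : legA k (m + 1) = legLam k m * legA k m := by
  have h := legL_deriv ((1 - X ^ 2) ^ (m + 1) * (legQ k (m + 1) * legQ k m)) (by simp) (by simp)
  have e : derivative ((1 - X ^ 2) ^ (m + 1) * (legQ k (m + 1) * legQ k m))
      = (1 - X ^ 2) ^ (m + 1) * legQ k (m + 1) ^ 2 + C (- legLam k m) * ((1 - X ^ 2) ^ m * legQ k m ^ 2) := by
    rw [derivative_mul, derivative_mul, dw, legQ_deriv, legQ_deriv]
    rw [map_neg]
    linear_combination ((1 - X ^ 2) ^ m * legQ k m) * legQ_ode k m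
  rw [e, legL_add, legL_C_mul] at h
  unfold legA
  linarith

open Polynomial in
/-- Wallis -/
theorem wallis_step (m : ℕ) : (2 * (m:ℝ) + 3) * legL ((1 - X ^ 2) ^ (m + 1)) = 2 * (m + 1) * legL ((1 - X ^ 2) ^ m) := by
  have h := legL_deriv (X * (1 - X ^ 2) ^ (m + 1)) (by simp) (by simp)
  have e : derivative (X * (1 - X ^ 2) ^ (m + 1) : ℝ[X])
      = C (2 * (m:ℝ) + 3) * (1 - X ^ 2) ^ (m + 1) + C (- (2 * ((m:ℝ) + 1))) * (1 - X ^ 2) ^ m := by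
    rw [derivative_mul, dw]
    simp only [map_mul, map_add, map_sub, map_neg, map_natCast, map_one, map_zero, map_ofNat, derivative_X]
    ring
  rw [e, legL_add, legL_C_mul, legL_C_mul] at h
  linarith

open Polynomial in
theorem wallis (m : ℕ) : ((2 * m + 1).factorial : ℝ) * legL ((1 - X ^ 2) ^ m) = 2 * 4 ^ m * (m.factorial : ℝ) ^ 2 := by
  induction m with
  | zero => simp [legL]; norm_num
  | succ m ih =>
    have h := wallis_step m
    rw [show 2 * (m + 1) + 1 = 2 * m + 1 + 1 + 1 by ring, Nat.factorial_succ, Nat.factorial_succ (2 * m + 1), Nat.factorial_succ m]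
    push_cast
    linear_combination ((2:ℝ) * m + 1 + 1) * ((2 * m + 1).factorial : ℝ) * h + 4 * ((m:ℝ) + 1) ^ 2 * ih

open Polynomial in
theorem legQ_top (k : ℕ) : legQ k k = C (((2 * k).factorial : ℝ) / (2 ^ k * k.factorial)) := by
  have hm : (legU k).Monic := by
    unfold legU
    apply Monic.pow
    exact monic_X_pow_sub_C (1:ℝ) two_ne_zero
  have hd : (legU k).natDegree = 2 * k := by
    unfold legU
    have := natDegree_X_pow_sub_C (n := 2) (r := (1:ℝ))
    rw [map_one] at this
    rw [natDegree_pow, this]; ring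
  have h : derivative^[k + k] (legU k) = C ((2 * k).factorial : ℝ) := by
    rw [← two_mul]
    have h0 : (derivative^[2 * k] (legU k)).natDegree = 0 := by
      have := natDegree_iterate_derivative (legU k) (2 * k)
      omega
    rw [eq_C_of_natDegree_eq_zero h0, coeff_iterate_derivative, zero_add]
    have : (legU k).coeff (2 * k) = 1 := by
      rw [← hd]; exact hm
    rw [this, Nat.descFactorial_self]
    simp
  rw [legQ, h, ← C_mul]
  congr 1
  ring

open Polynomial in
theorem legA_eq (k m : ℕ) (hm : m ≤ k) :
    legA k m = 2 / (2 * k + 1) * (k + m).factorial / (k - m).factorial := by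
  induction h : k - m generalizing m with
  | zero =>
    obtain rfl : m = k := by omega
    have hw := wallis m
    unfold legA
    rw [legQ_top, ← C_pow, mul_comm, legL_C_mul]
    rw [Nat.factorial_succ] at hw
    rw [← two_mul]
    have h1 : ((2 * m).factorial : ℝ) ≠ 0 := by positivity
    have h2 : ((m).factorial : ℝ) ≠ 0 := by positivity
    have h3 : (2 * (m:ℝ) + 1) ≠ 0 := by positivity
    have h4 : legL ((1 - X ^ 2) ^ m) = 2 * 4 ^ m * (m.factorial : ℝ) ^ 2 / ((2 * m + 1) * (2 * m).factorial) := by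
      rw [eq_div_iff (by positivity)]
      push_cast at hw
      linarith
    rw [h4]
    have h5 : (4:ℝ) ^ m = 2 ^ m * 2 ^ m := by rw [← mul_pow]; norm_num
    rw [h5]
    field_simp
    simp
  | succ d ih =>
    have h1 := ih (m + 1) (by omega) (by omega)
    rw [legA_succ] at h1
    have hk : (k:ℝ) = m + d + 1 := by
      have : k = m + d + 1 := by omega
      rw [this]; push_cast; ring
    have hl : legLam k m = (d + 1) * (k + m + 1) := by
      unfold legLam; rw [hk]; ring
    rw [hl, ← add_assoc, Nat.factorial_succ] at h1
    rw [Nat.factorial_succ]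
    push_cast at h1 ⊢
    have h2 : ((d).factorial : ℝ) ≠ 0 := by positivity
    have h3 : ((k:ℝ) + m + 1) ≠ 0 := by positivity
    have h4 : ((d:ℝ) + 1) ≠ 0 := by positivity
    have h5 : (2 * (k:ℝ) + 1) ≠ 0 := by positivity
    field_simp at h1 ⊢
    linarith


open Polynomial in
/-- `m² w^(m-1)` -/
def legV (m : ℕ) : ℝ[X] := C ((m:ℝ) ^ 2) * (1 - X ^ 2) ^ (m - 1)

open Polynomial in
theorem legV_w (m : ℕ) : legV m * (1 - X ^ 2) = (m : ℝ[X]) ^ 2 * (1 - X ^ 2) ^ m := by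
  unfold legV
  cases m with
  | zero => simp
  | succ m => simp; ring

open Polynomial in
theorem legV_d (m : ℕ) : (m : ℝ[X]) * derivative ((1 - X ^ 2 : ℝ[X]) ^ m) = - 2 * X * legV m := by
  unfold legV
  cases m with
  | zero => simp
  | succ m => rw [dw]; simp [(map_ofNat C 2 : (C 2 : ℝ[X]) = 2)]; ring

open Polynomial in
theorem legL_mD (m : ℕ) (p : ℝ[X]) : legL ((m : ℝ[X]) * derivative ((1 - X ^ 2) ^ m * p)) = 0 := by
  have : (m : ℝ[X]) = C (m:ℝ) := by simp
  rw [this, legL_C_mul]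
  cases m with
  | zero => simp
  | succ m => rw [legL_deriv _ (by simp) (by simp), mul_zero]

open Polynomial in
/-- `∫ w^(m+1) Q²` -/
def legB (k m : ℕ) : ℝ := legL ((1 - X ^ 2) ^ (m + 1) * legQ k m ^ 2)

open Polynomial in
theorem legB_eq (k m : ℕ) : (2 * (k:ℝ) - 1) * (2 * k + 3) * legB k m =
    (2 * legLam k m + (2 * m - 1) * (2 * m + 2)) * legA k m := by
  set w : ℝ[X] := 1 - X ^ 2 with hw
  set Q := legQ k m
  set Q1 := legQ k (m + 1)
  set l := legLam k m with hl
  have d1 := legL_deriv (w ^ (m + 1) * (X * w * Q1 ^ 2)) (by simp [hw]) (by simp [hw])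
  have d2 := legL_deriv (w ^ (m + 1) * (Q * Q1)) (by simp [hw]) (by simp [hw])
  have d3 := legL_deriv (w ^ (m + 1) * (X ^ 2 * Q * Q1)) (by simp [hw]) (by simp [hw])
  have d4 := legL_deriv (w ^ (m + 1) * (X * Q ^ 2)) (by simp [hw]) (by simp [hw])
  have e : derivative (w ^ (m + 1) * (X * w * Q1 ^ 2)) + C (-1) * derivative (w ^ (m + 1) * (Q * Q1))
      + C (-(2 * (m:ℝ) - 1)) * derivative (w ^ (m + 1) * (X ^ 2 * Q * Q1))
      + C (2 * (m:ℝ) - 1 + l) * derivative (w ^ (m + 1) * (X * Q ^ 2))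
      = C (-(2 * (m:ℝ) - 1) * l + (2 * m - 1 + l) * (2 * m + 3)) * (w ^ (m + 1) * Q ^ 2)
        + C (-2 * l - 2 * (m + 1) * (2 * m - 1)) * (w ^ m * Q ^ 2) := by
    have ode := legQ_ode k m
    have hQ : derivative Q = Q1 := legQ_deriv k m
    have hQ1 : derivative Q1 = legQ k (m + 2) := legQ_deriv k (m + 1)
    have dwm : derivative (w ^ (m + 1)) = - C (2 * ((m:ℝ) + 1)) * X * w ^ m := dw m
    have dw1 : derivative w = - 2 * X := by
      simp [hw]; norm_num
    simp only [derivative_mul, dwm, dw1, hQ, hQ1, derivative_X, derivative_sq]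
    simp only [map_mul, map_add, map_sub, map_neg, map_natCast, map_one, map_ofNat] at ode ⊢
    rw [hw]
    linear_combination (2 * X * (1 - X ^ 2) ^ (m + 1) * Q1 - (1 - X ^ 2) ^ m * Q
      - (2 * (m : ℝ[X]) - 1) * (1 - X ^ 2) ^ m * X ^ 2 * Q) * ode
  have := congrArg legL e
  simp only [legL_add, legL_C_mul, d1, d2, d3, d4] at this
  have hA : legL (w ^ m * Q ^ 2) = legA k m := rfl
  have hB : legL (w ^ (m + 1) * Q ^ 2) = legB k m := rfl
  rw [hA, hB] at this
  have hlam : l = ((k:ℝ) - m) * (k + m + 1) := rfl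
  rw [hlam] at this ⊢
  linear_combination -this

open Polynomial in
/-- the one-dimensional integrand -/
def legInt (k m : ℕ) (a : ℝ) : ℝ[X] :=
  (1 - X ^ 2) ^ m * ((1 - X ^ 2) * (C a * legQ k m - X * legQ k (m + 1)) ^ 2
    + 2 * (m : ℝ[X]) * legQ k m * (C a * legQ k m - X * legQ k (m + 1)))

open Polynomial in
theorem legI_eq (k m : ℕ) (a : ℝ) : legL (legInt k m a + 2 * (legV m * legQ k m ^ 2)) =
    (a ^ 2 + a * (2 * m + 3) - legLam k m + (2 * m + 3)) * legB k m +
    (-a * 2 * (m + 1) + legLam k m - 2 * (m + 1) + 2 * m * a + m * (1 + 2 * m)) * legA k m := by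
  set w : ℝ[X] := 1 - X ^ 2 with hw
  set Q := legQ k m with hQd
  set Q1 := legQ k (m + 1) with hQ1d
  set l := legLam k m with hl
  have d3 := legL_deriv (w ^ (m + 1) * (X ^ 2 * Q * Q1)) (by simp [hw]) (by simp [hw])
  have d4 := legL_deriv (w ^ (m + 1) * (X * Q ^ 2)) (by simp [hw]) (by simp [hw])
  have d5 := legL_mD m (X * Q ^ 2)
  have e : legInt k m a + 2 * (legV m * Q ^ 2) =
     C (a ^ 2 + a * (2 * m + 3) - l + (2 * m + 3)) * (w ^ (m + 1) * Q ^ 2) +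
     C (-a * 2 * (m + 1) + l - 2 * (m + 1) + 2 * m * a + m * (1 + 2 * m)) * (w ^ m * Q ^ 2)
     + derivative (w ^ (m + 1) * (X ^ 2 * Q * Q1)) + C (-a - 1) * derivative (w ^ (m + 1) * (X * Q ^ 2))
     + C (-1) * ((m : ℝ[X]) * derivative ((1 - X ^ 2) ^ m * (X * Q ^ 2))) := by
    have ode := legQ_ode k m
    have hQ : derivative Q = Q1 := legQ_deriv k m
    have hQ1 : derivative Q1 = legQ k (m + 2) := legQ_deriv k (m + 1)
    have v1 := legV_w m
    have v2 := legV_d m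
    rw [derivative_mul (f := (1 - X ^ 2) ^ m), mul_add (m : ℝ[X]), ← mul_assoc (m : ℝ[X]), v2]
    unfold legInt
    have dwm : derivative (w ^ (m + 1)) = - C (2 * ((m:ℝ) + 1)) * X * w ^ m := dw m
    simp only [derivative_mul, dwm, hQ, hQ1, derivative_X, derivative_sq]
    simp only [map_mul, map_add, map_sub, map_neg, map_natCast, map_one, map_ofNat, map_pow] at ode ⊢
    rw [← hQd, ← hQ1d, hw]
    linear_combination (-(1 - X ^ 2) ^ m * X ^ 2 * Q) * ode + 2 * Q ^ 2 * v1
  rw [e]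
  simp only [legL_add, legL_C_mul, d3, d4, d5]
  have hA : legL (w ^ m * Q ^ 2) = legA k m := rfl
  have hB : legL (w ^ (m + 1) * Q ^ 2) = legB k m := rfl
  rw [hA, hB]
  ring

open Polynomial in
theorem legI_int (k m : ℕ) : (2 * (k:ℝ) - 1) * legL (legInt k m ((k:ℝ) - m) + 2 * (legV m * legQ k m ^ 2)) =
    ((k:ℝ) ^ 2 - k + m ^ 2) * (2 * k + 1) * legA k m := by
  have h1 := legI_eq k m ((k:ℝ) - m)
  have h2 := legB_eq k m
  have h3 : (2 * (k:ℝ) + 3) ≠ 0 := by positivity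
  apply mul_left_cancel₀ h3
  rw [h1]
  unfold legLam at h2 ⊢
  linear_combination (((k:ℝ) - m) ^ 2 + ((k:ℝ) - m) * (2 * m + 3) - ((k:ℝ) - m) * (k + m + 1) + (2 * m + 3)) * h2

open Polynomial in
theorem legI_ext (k m : ℕ) : (2 * (k:ℝ) + 3) * legL (legInt k m (-(k:ℝ) - 1 - m) + 2 * (legV m * legQ k m ^ 2)) =
    (((k:ℝ) + 1) * (k + 2) + m ^ 2) * (2 * k + 1) * legA k m := by
  have h1 := legI_eq k m (-(k:ℝ) - 1 - m)
  have h2 := legB_eq k m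
  have h3 : (2 * (k:ℝ) - 1) ≠ 0 := by
    intro h
    have : (2 * k : ℤ) = 1 := by
      have : (2 * (k:ℝ)) = 1 := by linarith
      exact_mod_cast this
    omega
  apply mul_left_cancel₀ h3
  rw [h1]
  unfold legLam at h2 ⊢
  linear_combination ((-(k:ℝ) - 1 - m) ^ 2 + (-(k:ℝ) - 1 - m) * (2 * m + 3) - ((k:ℝ) - m) * (k + m + 1) + (2 * m + 3)) * h2


/-- real or imaginary part -/
def partC (sgn : Bool) : ℂ →L[ℝ] ℝ := if sgn then Complex.reCLM else Complex.imCLM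

/-- the complex variable `x₁ + i x₂` -/
def zCLM : E3 →L[ℝ] ℂ :=
  (EuclideanSpace.proj 1 : E3 →L[ℝ] ℝ).smulRight (1:ℂ) + (EuclideanSpace.proj 2 : E3 →L[ℝ] ℝ).smulRight Complex.I

theorem zCLM_apply (x : E3) : zCLM x = ⟨x 1, x 2⟩ := by
  apply Complex.ext <;> simp [zCLM]

theorem part_pow (m : ℕ) (sgn : Bool) (z : ℂ) :
    partC sgn (z ^ m) = ‖z‖ ^ m * PhiFac m sgn (Complex.arg z) := by
  have h : z ^ m = ((‖z‖ ^ m : ℝ) : ℂ) * (Complex.exp (((m * Complex.arg z : ℝ) : ℂ) * Complex.I)) := by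
    conv_lhs => rw [← Complex.norm_mul_exp_arg_mul_I z]
    rw [mul_pow, ← Complex.exp_nat_mul]
    push_cast
    ring_nf
  rw [h]
  cases sgn <;> simp only [partC, PhiFac, if_true, Bool.false_eq_true, if_false, Complex.reCLM_apply, Complex.imCLM_apply,
    Complex.re_ofReal_mul, Complex.im_ofReal_mul, Complex.exp_ofReal_mul_I_re, Complex.exp_ofReal_mul_I_im]

/-- degree of the Legendre polynomial used for `N` -/
def legDeg (N : ℤ) : ℕ := if 0 ≤ N then N.toNat else (-N - 1).toNat

theorem assocLegendre_eq (N : ℤ) (m : ℕ) (t : ℝ) :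
    assocLegendre N m t = (1 - t ^ 2) ^ ((m : ℝ) / 2) * (legQ (legDeg N) m).eval t := by
  unfold assocLegendre legDeg assocLegendreNat
  split_ifs <;> simp only [iteratedDeriv_legendreP]

theorem solidU_eq (N : ℤ) (m : ℕ) (sgn : Bool) (x : E3) (hx : 0 < sphRho x) :
    solidU N m sgn x = sphRho x ^ (N - m) * (legQ (legDeg N) m).eval (x 0 / sphRho x) * partC sgn (zCLM x ^ m) := by
  have hsq : sphRho x ^ 2 = x 0 ^ 2 + x 1 ^ 2 + x 2 ^ 2 := by
    rw [sphRho, Real.sq_sqrt (by positivity)]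
  have hn : ‖zCLM x‖ ^ 2 = x 1 ^ 2 + x 2 ^ 2 := by
    rw [zCLM_apply, Complex.sq_norm, Complex.normSq_mk]; ring
  have h1 : 1 - (x 0 / sphRho x) ^ 2 = (‖zCLM x‖ / sphRho x) ^ 2 := by
    rw [div_pow, div_pow, hn]
    field_simp
    linarith
  have h2 : ((‖zCLM x‖ / sphRho x) ^ 2) ^ ((m:ℝ) / 2) = (‖zCLM x‖ / sphRho x) ^ m := by
    rw [← Real.rpow_natCast _ 2, ← Real.rpow_mul (by positivity), ← Real.rpow_natCast]
    congr 1
    push_cast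
    ring
  rw [solidU, assocLegendre_eq, h1, h2, part_pow, sphPhi, ← zCLM_apply, zpow_sub₀ hx.ne', zpow_natCast, div_pow]
  field_simp

theorem sphRho_hasFDerivAt (x : E3) (hx : 0 < sphRho x) :
    HasFDerivAt sphRho ((sphRho x)⁻¹ • (x 0 • (EuclideanSpace.proj 0 : E3 →L[ℝ] ℝ)
      + x 1 • (EuclideanSpace.proj 1 : E3 →L[ℝ] ℝ) + x 2 • (EuclideanSpace.proj 2 : E3 →L[ℝ] ℝ))) x := by
  have hc : ∀ i : Fin 3, HasFDerivAt (fun y : E3 => y i) (EuclideanSpace.proj i : E3 →L[ℝ] ℝ) x :=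
    fun i => (EuclideanSpace.proj i : E3 →L[ℝ] ℝ).hasFDerivAt
  have h0 : x 0 ^ 2 + x 1 ^ 2 + x 2 ^ 2 ≠ 0 := by
    intro h; rw [sphRho, h] at hx; simp at hx
  have h := ((((hc 0).pow 2).add ((hc 1).pow 2)).add ((hc 2).pow 2)).sqrt h0
  refine h.congr_fderiv ?_
  ext v
  simp [sphRho]
  ring

theorem pd_coe (i : Fin 3) (U : E3 → ℝ) (U' : E3 →L[ℝ] ℝ) (x : E3) (h : HasFDerivAt U U' x) :
    pd i (fun y => ((U y : ℝ) : H)) x = ((U' (EuclideanSpace.single i 1) : ℝ) : H) := by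
  have h1 : HasFDerivAt (fun y => ((U y : ℝ) : H)) ((algebraMapCLM ℝ H).comp U') x :=
    (algebraMapCLM ℝ H).hasFDerivAt.comp x h
  rw [pd, h1.fderiv]
  rfl

/-- the vector part of the gradient -/
theorem grad_sq (n : ℤ) (m : ℕ) (sgn : Bool) (x : E3) (hx : 0 < sphRho x)
    (ρ t Q Q1 R C E : ℝ) (dρ : sphRho x = ρ) (dt : x 0 * ρ⁻¹ = t)
    (dQ : (legQ (legDeg (n + 1)) m).eval t = Q) (dQ1 : (legQ (legDeg (n + 1)) (m + 1)).eval t = Q1)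
    (dR : R = ((n + 1 - m : ℤ) : ℝ) * Q - t * Q1) (dC : partC sgn (zCLM x ^ m) = C)
    (dE : ρ ^ (n - m) = E) :
    (Xmon n m sgn x).imI ^ 2 + (Xmon n m sgn x).imJ ^ 2 =
       E ^ 2 * ((x 1 ^ 2 + x 2 ^ 2) * R ^ 2 / ρ ^ 2 * C ^ 2 + 2 * m * Q * R * C ^ 2
        + ρ ^ 2 * Q ^ 2 * (m ^ 2 * (x 1 ^ 2 + x 2 ^ 2) ^ (m - 1))) := by
  have hρ : ρ ≠ 0 := dρ ▸ hx.ne'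
  have hρ' : sphRho x ≠ 0 := hx.ne'
  set ζ : ℂ := m * zCLM x ^ (m - 1) with hζ
  set Qp := legQ (legDeg (n + 1)) m
  have hd := sphRho_hasFDerivAt x hx
  have hc : HasFDerivAt (fun y : E3 => y 0) (EuclideanSpace.proj 0 : E3 →L[ℝ] ℝ) x :=
    (EuclideanSpace.proj 0 : E3 →L[ℝ] ℝ).hasFDerivAt
  have hz : HasFDerivAt (fun y => zCLM y ^ m) _ x := (zCLM.hasFDerivAt (x := x)).pow m
  have hP : HasFDerivAt (fun y => partC sgn (zCLM y ^ m)) _ x := (partC sgn).hasFDerivAt.comp x hz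
  have hE : HasFDerivAt (fun y => sphRho y ^ (n + 1 - m)) _ x :=
    (hasDerivAt_zpow (n + 1 - m) (sphRho x) (Or.inl hρ')).comp_hasFDerivAt x hd
  have hi : HasFDerivAt (fun y => (sphRho y)⁻¹) _ x := (hasDerivAt_inv hρ').comp_hasFDerivAt x hd
  have ht : HasFDerivAt (fun y : E3 => y 0 * (sphRho y)⁻¹) _ x := hc.mul hi
  have hQ : HasFDerivAt (fun y : E3 => Qp.eval (y 0 * (sphRho y)⁻¹)) _ x :=
    HasDerivAt.comp_hasFDerivAt (h₂ := fun s : ℝ => Qp.eval s) x (Qp.hasDerivAt (x 0 * (sphRho x)⁻¹)) ht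
  have hU := (hE.mul hQ).mul hP
  have hev : solidU (n + 1) m sgn =ᶠ[nhds x] fun y => sphRho y ^ (n + 1 - m) * Qp.eval (y 0 * (sphRho y)⁻¹) * partC sgn (zCLM y ^ m) := by
    filter_upwards [hd.continuousAt.eventually (lt_mem_nhds hx)] with y hy
    rw [solidU_eq _ _ _ _ hy, div_eq_mul_inv]
  have hU2 := hU.congr_of_eventuallyEq hev
  clear hev
  obtain ⟨U', hU'⟩ : ∃ U', U' = fderiv ℝ (solidU (n + 1) m sgn) x := ⟨_, rfl⟩
  have hpd : ∀ i, pd i (solidUq (n + 1) m sgn) x = ((U' (EuclideanSpace.single i 1) : ℝ) : H) :=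
    fun i => pd_coe i _ _ x (hU' ▸ hU2.differentiableAt.hasFDerivAt)
  have hI : (Xmon n m sgn x).imI = - U' (EuclideanSpace.single 1 1) := by
    have a1 : qe1.re = 0 := rfl
    have a2 : qe1.imI = 1 := rfl
    have a3 : qe1.imJ = 0 := rfl
    have a4 : qe1.imK = 0 := rfl
    have b1 : qe2.re = 0 := rfl
    have b2 : qe2.imI = 0 := rfl
    have b3 : qe2.imJ = 1 := rfl
    have b4 : qe2.imK = 0 := rfl
    simp [Xmon, Dop, hpd, Quaternion.imI_mul, Quaternion.imJ_mul, a1, a2, a3, a4, b1, b2, b3, b4]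
  have hJ : (Xmon n m sgn x).imJ = - U' (EuclideanSpace.single 2 1) := by
    have a1 : qe1.re = 0 := rfl
    have a2 : qe1.imI = 1 := rfl
    have a3 : qe1.imJ = 0 := rfl
    have a4 : qe1.imK = 0 := rfl
    have b1 : qe2.re = 0 := rfl
    have b2 : qe2.imI = 0 := rfl
    have b3 : qe2.imJ = 1 := rfl
    have b4 : qe2.imK = 0 := rfl
    simp [Xmon, Dop, hpd, Quaternion.imI_mul, Quaternion.imJ_mul, a1, a2, a3, a4, b1, b2, b3, b4]
  have hz1 : zCLM (EuclideanSpace.single 1 1) = 1 := by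
    rw [zCLM_apply]; apply Complex.ext <;> simp
  have hz2 : zCLM (EuclideanSpace.single 2 1) = Complex.I := by
    rw [zCLM_apply]; apply Complex.ext <;> simp
  have hexp : ρ ^ (n + 1 - m) = ρ * E := by
    have : n + 1 - (m:ℤ) = n - m + 1 := by ring
    rw [this, zpow_add_one₀ hρ, mul_comm, dE]
  have hexp2 : ρ ^ (n + 1 - m - 1) = E := by
    rw [← dE]; congr 1; ring
  have hQ1 : Polynomial.derivative Qp = legQ (legDeg (n + 1)) (m + 1) := legQ_deriv _ _
  have hU1 : U' (EuclideanSpace.single 1 1) = E * (x 1 / ρ * R * C + ρ * Q * partC sgn ζ) := by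
    rw [hU', hU2.fderiv]
    simp [hz1, hexp, hexp2, dρ, dt, hQ1, dQ, dQ1, dC]
    rw [← hζ, dR, ← dt]
    push_cast
    field_simp
    ring
  have hU2' : U' (EuclideanSpace.single 2 1) = E * (x 2 / ρ * R * C + ρ * Q * partC sgn (ζ * Complex.I)) := by
    rw [hU', hU2.fderiv]
    simp [hz2, hexp, hexp2, dρ, dt, hQ1, dQ, dQ1, dC]
    rw [← hζ, dR, ← dt]
    push_cast
    field_simp
    ring
  have hζz : ζ * zCLM x = m * zCLM x ^ m := by
    rw [hζ]
    cases m with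
    | zero => simp
    | succ m => simp [pow_succ, mul_assoc]
  have hζn : ζ.re ^ 2 + ζ.im ^ 2 = m ^ 2 * (x 1 ^ 2 + x 2 ^ 2) ^ (m - 1) := by
    have : Complex.normSq ζ = m ^ 2 * (x 1 ^ 2 + x 2 ^ 2) ^ (m - 1) := by
      rw [hζ, zCLM_apply, map_mul, map_pow, Complex.normSq_natCast, Complex.normSq_mk]
      ring
    rw [← this, Complex.normSq_apply]; ring
  have hcr : x 1 * partC sgn ζ + x 2 * partC sgn (ζ * Complex.I) = m * C := by
    have h1 : m * C = partC sgn (ζ * zCLM x) := by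
      rw [hζz, ← nsmul_eq_mul m (zCLM x ^ m), map_nsmul, nsmul_eq_mul, dC]
    rw [h1, zCLM_apply]
    cases sgn <;> simp [partC] <;> ring
  have hsum : partC sgn ζ ^ 2 + partC sgn (ζ * Complex.I) ^ 2 = m ^ 2 * (x 1 ^ 2 + x 2 ^ 2) ^ (m - 1) := by
    rw [← hζn]
    cases sgn <;> simp [partC] <;> ring
  rw [hI, hJ, hU1, hU2']
  have e1 : ρ * ρ⁻¹ = 1 := mul_inv_cancel₀ hρ
  simp only [div_eq_mul_inv]
  linear_combination E ^ 2 * (2 * Q * R * C * hcr + ρ ^ 2 * Q ^ 2 * hsum) + E ^ 2 * (2 * R * C * Q * (x 1 * partC sgn ζ + x 2 * partC sgn (ζ * Complex.I))) * e1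


/-- explicit version of the integrand -/
def gradF (n : ℤ) (m : ℕ) (sgn : Bool) (x : E3) : ℝ :=
  (sphRho x ^ (n - m)) ^ 2 *
    ((x 1 ^ 2 + x 2 ^ 2) * (((n + 1 - m : ℤ) : ℝ) * (legQ (legDeg (n + 1)) m).eval (x 0 * (sphRho x)⁻¹)
        - (x 0 * (sphRho x)⁻¹) * (legQ (legDeg (n + 1)) (m + 1)).eval (x 0 * (sphRho x)⁻¹)) ^ 2 / sphRho x ^ 2
          * (partC sgn (zCLM x ^ m)) ^ 2
      + 2 * m * (legQ (legDeg (n + 1)) m).eval (x 0 * (sphRho x)⁻¹)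
        * (((n + 1 - m : ℤ) : ℝ) * (legQ (legDeg (n + 1)) m).eval (x 0 * (sphRho x)⁻¹)
        - (x 0 * (sphRho x)⁻¹) * (legQ (legDeg (n + 1)) (m + 1)).eval (x 0 * (sphRho x)⁻¹))
          * (partC sgn (zCLM x ^ m)) ^ 2
      + sphRho x ^ 2 * (legQ (legDeg (n + 1)) m).eval (x 0 * (sphRho x)⁻¹) ^ 2
        * (m ^ 2 * (x 1 ^ 2 + x 2 ^ 2) ^ (m - 1)))

theorem gradF_eq (n : ℤ) (m : ℕ) (sgn : Bool) (x : E3) (hx : 0 < sphRho x) :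
    (Xmon n m sgn x).imI ^ 2 + (Xmon n m sgn x).imJ ^ 2 = gradF n m sgn x :=
  grad_sq n m sgn x hx _ _ _ _ _ _ _ rfl rfl rfl rfl rfl rfl rfl

theorem sphRho_measurable : Measurable sphRho := by
  have : Continuous sphRho := by unfold sphRho; fun_prop
  exact this.measurable

theorem gradF_measurable (n : ℤ) (m : ℕ) (sgn : Bool) : Measurable (gradF n m sgn) := by
  have h1 := sphRho_measurable
  have hi : ∀ i : Fin 3, Measurable (fun x : E3 => x i) := fun i => by
    have : Continuous (fun x : E3 => x i) := by fun_prop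
    exact this.measurable
  have h0 := hi 0
  have h01 := hi 1
  have h02 := hi 2
  have ht : Measurable (fun x : E3 => x 0 * (sphRho x)⁻¹) := h0.mul h1.inv
  have hQ : ∀ p : Polynomial ℝ, Measurable (fun x : E3 => p.eval (x 0 * (sphRho x)⁻¹)) :=
    fun p => p.continuous.measurable.comp ht
  have hq1 := hQ (legQ (legDeg (n + 1)) m)
  have hq2 := hQ (legQ (legDeg (n + 1)) (m + 1))
  have hP : Measurable (fun x : E3 => partC sgn (zCLM x ^ m)) := by
    have : Continuous (fun x : E3 => partC sgn (zCLM x ^ m)) := by fun_prop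
    exact this.measurable
  have hz : Measurable (fun x : E3 => sphRho x ^ (n - m)) := by
    cases h : n - (m:ℤ) with
    | ofNat k => simp only [Int.ofNat_eq_natCast, zpow_natCast]; exact h1.pow_const _
    | negSucc k => simp only [zpow_negSucc]; exact (h1.pow_const _).inv
  unfold gradF
  fun_prop

theorem sphRho_norm (x : E3) : sphRho x = ‖x‖ := by
  rw [EuclideanSpace.norm_eq, Fin.sum_univ_three, sphRho]
  simp

/-- angular part -/
def angG (n : ℤ) (m : ℕ) (sgn : Bool) (φ : ℝ) : Polynomial ℝ :=
  Polynomial.C (PhiFac m sgn φ ^ 2) * legInt (legDeg (n + 1)) m ((n + 1 - m : ℤ) : ℝ)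
    + legV m * legQ (legDeg (n + 1)) m ^ 2

theorem sph_rho (r θ φ : ℝ) (hr : 0 < r) :
    sphRho !₂[r * cos θ, r * sin θ * cos φ, r * sin θ * sin φ] = r := by
  rw [sphRho]
  have : (r * cos θ) ^ 2 + (r * sin θ * cos φ) ^ 2 + (r * sin θ * sin φ) ^ 2 = r ^ 2 := by
    have h1 := sin_sq_add_cos_sq θ
    have h2 := sin_sq_add_cos_sq φ
    linear_combination (r ^ 2 * sin θ ^ 2) * h2 + r ^ 2 * h1
  simp [this, Real.sqrt_sq hr.le]

theorem gradF_sph (n : ℤ) (m : ℕ) (sgn : Bool) (r θ φ : ℝ) (hr : 0 < r) (hθ : θ ∈ Set.Ioo 0 π)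
    (hφ : φ ∈ Set.Ioo (-π) π) :
    gradF n m sgn !₂[r * cos θ, r * sin θ * cos φ, r * sin θ * sin φ] =
      r ^ (2 * n) * (angG n m sgn φ).eval (cos θ) := by
  have hs := sin_pos_of_mem_Ioo hθ
  have hz : zCLM !₂[r * cos θ, r * sin θ * cos φ, r * sin θ * sin φ]
      = ((r * sin θ : ℝ) : ℂ) * (Complex.cos φ + Complex.sin φ * Complex.I) := by
    rw [zCLM_apply]
    apply Complex.ext
    · simp [← Complex.ofReal_cos, ← Complex.ofReal_sin]
    · simp [← Complex.ofReal_cos, ← Complex.ofReal_sin]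
  have hP : partC sgn (zCLM !₂[r * cos θ, r * sin θ * cos φ, r * sin θ * sin φ] ^ m)
      = (r * sin θ) ^ m * PhiFac m sgn φ := by
    rw [part_pow, hz, Complex.arg_mul_cos_add_sin_mul_I (by positivity) ⟨hφ.1, hφ.2.le⟩]
    congr 2
    rw [norm_mul, Complex.norm_cos_add_sin_mul_I, mul_one, Complex.norm_real, Real.norm_of_nonneg (by positivity)]
  have h12 : (r * sin θ * cos φ) ^ 2 + (r * sin θ * sin φ) ^ 2 = r ^ 2 * sin θ ^ 2 := by
    have h2 := sin_sq_add_cos_sq φ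
    linear_combination (r ^ 2 * sin θ ^ 2) * h2
  have ht : r * cos θ * r⁻¹ = cos θ := by field_simp
  have hsin : 1 - cos θ ^ 2 = sin θ ^ 2 := by linarith [sin_sq_add_cos_sq θ]
  unfold gradF
  rw [hP, sph_rho r θ φ hr]
  simp only [PiLp.toLp_apply, Matrix.cons_val_zero, Matrix.cons_val_one, Matrix.cons_val]
  rw [h12, ht]
  unfold angG legInt legV
  simp only [Polynomial.eval_add, Polynomial.eval_mul, Polynomial.eval_sub, Polynomial.eval_pow, Polynomial.eval_C,
    Polynomial.eval_X, Polynomial.eval_one, Polynomial.eval_natCast, Polynomial.eval_ofNat, hsin]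
  have hE : (r ^ (n - m)) ^ 2 * (r ^ m) ^ 2 = r ^ (2 * n) := by
    rw [← mul_pow, ← zpow_natCast r m, ← zpow_add₀ hr.ne', ← zpow_natCast _ 2, ← zpow_mul]
    congr 1; push_cast; ring
  rw [← hE]
  generalize Polynomial.eval (cos θ) (legQ (legDeg (n + 1)) m) = Q
  generalize Polynomial.eval (cos θ) (legQ (legDeg (n + 1)) (m + 1)) = Q1
  generalize r ^ (n - m) = E
  generalize ((n + 1 - m : ℤ) : ℝ) = a
  cases m with
  | zero => simp; field_simp; simp
  | succ m =>
    simp only [Nat.add_sub_cancel, mul_pow]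
    field_simp
    ring

theorem legL_cos (p : Polynomial ℝ) : ∫ θ in Set.Ioo 0 π, sin θ * p.eval (cos θ) = legL p := by
  rw [← integral_Ioc_eq_integral_Ioo, ← intervalIntegral.integral_of_le pi_pos.le]
  have h := intervalIntegral.integral_comp_mul_deriv (a := 0) (b := π) (f := cos) (f' := fun x => - sin x)
    (g := fun t => p.eval t) (fun x _ => hasDerivAt_cos x) (by fun_prop) p.continuous
  simp only [cos_zero, cos_pi, Function.comp] at h
  rw [intervalIntegral.integral_symm (-1) 1] at h
  unfold legL
  rw [← neg_neg (∫ t in (-1:ℝ)..1, p.eval t), ← h, ← intervalIntegral.integral_neg]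
  congr 1
  ext x
  ring

theorem ang_nonneg (n : ℤ) (m : ℕ) (sgn : Bool) (θ φ : ℝ) (hθ : θ ∈ Set.Ioo 0 π)
    (hφ : φ ∈ Set.Ioo (-π) π) : 0 ≤ sin θ * (angG n m sgn φ).eval (cos θ) := by
  have hs := sin_pos_of_mem_Ioo hθ
  have h := gradF_sph n m sgn 1 θ φ one_pos hθ hφ
  rw [← gradF_eq _ _ _ _ (by rw [sph_rho _ _ _ one_pos]; exact one_pos)] at h
  simp only [one_zpow, one_mul] at h
  rw [← h]
  positivity

theorem int_phi (m : ℕ) (sgn : Bool) (h0 : m = 0 → sgn = true) :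
    ∫ φ in Set.Ioo (-π) π, PhiFac m sgn φ ^ 2 = π * ((if m = 0 then (1:ℝ) else 0) + 1) := by
  rw [← integral_Ioc_eq_integral_Ioo, ← intervalIntegral.integral_of_le (by linarith [pi_pos])]
  by_cases hm : m = 0
  · rw [h0 hm, hm]
    simp [PhiFac]
    ring
  · have hm' : (m:ℝ) ≠ 0 := by exact_mod_cast hm
    have hder : ∀ φ : ℝ, HasDerivAt (fun φ => sin (m * φ) * cos (m * φ) / (2 * m))
        ((cos (m * φ) ^ 2 - sin (m * φ) ^ 2) / 2) φ := by
      intro φ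
      have hl : HasDerivAt (fun φ : ℝ => m * φ) (m:ℝ) φ := by
        simpa using (hasDerivAt_id φ).const_mul (m:ℝ)
      have := (hl.sin.mul hl.cos).div_const (2 * (m:ℝ))
      refine this.congr_deriv ?_
      field_simp
      ring
    have s1 : sin (m * π) = 0 := sin_nat_mul_pi m
    have s2 : sin (m * -π) = 0 := by rw [mul_neg, sin_neg, s1, neg_zero]
    rw [if_neg hm]
    cases sgn
    · have : ∀ φ ∈ Set.uIcc (-π) π, HasDerivAt (fun φ => φ / 2 - sin (m * φ) * cos (m * φ) / (2 * m)) (PhiFac m false φ ^ 2) φ := by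
        intro φ _
        refine (((hasDerivAt_id φ).div_const 2).sub (hder φ)).congr_deriv ?_
        simp only [PhiFac, Bool.false_eq_true, if_false]
        linarith [sin_sq_add_cos_sq (m * φ)]
      rw [intervalIntegral.integral_eq_sub_of_hasDerivAt this]
      · simp only [s1, s2]; ring
      · apply Continuous.intervalIntegrable; unfold PhiFac; simp; fun_prop
    · have : ∀ φ ∈ Set.uIcc (-π) π, HasDerivAt (fun φ => φ / 2 + sin (m * φ) * cos (m * φ) / (2 * m)) (PhiFac m true φ ^ 2) φ := by
        intro φ _
        refine (((hasDerivAt_id φ).div_const 2).add (hder φ)).congr_deriv ?_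
        simp only [PhiFac, if_true]
        linarith [sin_sq_add_cos_sq (m * φ)]
      rw [intervalIntegral.integral_eq_sub_of_hasDerivAt this]
      · simp only [s1, s2]; ring
      · apply Continuous.intervalIntegrable; unfold PhiFac; simp; fun_prop

theorem PhiFac_cont (m : ℕ) (sgn : Bool) : Continuous (PhiFac m sgn) := by
  unfold PhiFac
  cases sgn <;> simp <;> fun_prop

theorem lint_theta (n : ℤ) (m : ℕ) (sgn : Bool) (φ : ℝ) (hφ : φ ∈ Set.Ioo (-π) π) :
    ∫⁻ θ in Set.Ioo 0 π, ENNReal.ofReal (sin θ * (angG n m sgn φ).eval (cos θ))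
      = ENNReal.ofReal (legL (angG n m sgn φ)) := by
  rw [← ofReal_integral_eq_lintegral_ofReal, legL_cos]
  · have : Continuous (fun θ => sin θ * (angG n m sgn φ).eval (cos θ)) :=
      continuous_sin.mul ((angG n m sgn φ).continuous.comp continuous_cos)
    exact (this.integrableOn_Icc).mono_set Set.Ioo_subset_Icc_self
  · rw [Filter.EventuallyLE, ae_restrict_iff' measurableSet_Ioo]
    exact Filter.Eventually.of_forall fun θ hθ => ang_nonneg n m sgn θ φ hθ hφ

theorem lint_phi (n : ℤ) (m : ℕ) (sgn : Bool) (h0 : m = 0 → sgn = true) :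
    ∫⁻ φ in Set.Ioo (-π) π, ENNReal.ofReal (legL (angG n m sgn φ))
      = ENNReal.ofReal (π * ((if m = 0 then (1:ℝ) else 0) + 1) *
        legL (legInt (legDeg (n + 1)) m ((n + 1 - m : ℤ) : ℝ) + 2 * (legV m * legQ (legDeg (n + 1)) m ^ 2))) := by
  have hG : ∀ φ, legL (angG n m sgn φ) = PhiFac m sgn φ ^ 2 * legL (legInt (legDeg (n + 1)) m ((n + 1 - m : ℤ) : ℝ))
      + legL (legV m * legQ (legDeg (n + 1)) m ^ 2) := by
    intro φ
    rw [angG, legL_add, legL_C_mul]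
  have hc : Continuous (fun φ => PhiFac m sgn φ ^ 2) := (PhiFac_cont m sgn).pow 2
  rw [← ofReal_integral_eq_lintegral_ofReal]
  · congr 1
    simp only [hG]
    rw [integral_add, integral_mul_const, int_phi m sgn h0]
    · have h2 : (2 : Polynomial ℝ) = Polynomial.C 2 := (map_ofNat Polynomial.C 2).symm
      rw [legL_add, h2, legL_C_mul]
      by_cases hm : m = 0
      · subst hm
        simp [legV, legL]
      · simp [hm]
        rw [max_eq_left (by linarith [pi_pos])]
        ring
    · exact ((hc.mul continuous_const).integrableOn_Icc).mono_set Set.Ioo_subset_Icc_self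
    · exact (continuous_const.integrableOn_Icc (a := -π) (b := π)).mono_set Set.Ioo_subset_Icc_self
  · simp only [hG]
    exact (((hc.mul continuous_const).add continuous_const).integrableOn_Icc).mono_set Set.Ioo_subset_Icc_self
  · rw [Filter.EventuallyLE, ae_restrict_iff' measurableSet_Ioo]
    refine Filter.Eventually.of_forall fun φ hφ => ?_
    rw [Pi.zero_apply, ← legL_cos]
    exact setIntegral_nonneg measurableSet_Ioo fun θ hθ => ang_nonneg n m sgn θ φ hθ hφ

theorem main_int (n : ℤ) (m : ℕ) (sgn : Bool) (h0 : m = 0 → sgn = true) (D : Set ℝ) (hD : MeasurableSet D)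
    (Rad : ℝ) (hR0 : 0 ≤ Rad)
    (hR : ∫⁻ r in Set.Ioi 0, D.indicator (fun r : ℝ => ENNReal.ofReal (r ^ (2 * n + 2))) r = ENNReal.ofReal Rad)
    (I : ℝ) (hI : I = legL (legInt (legDeg (n + 1)) m ((n + 1 - m : ℤ) : ℝ) + 2 * (legV m * legQ (legDeg (n + 1)) m ^ 2)))
    (hI0 : 0 ≤ I) :
    ∫ x in sphRho ⁻¹' D, ((Xmon n m sgn x).imI ^ 2 + (Xmon n m sgn x).imJ ^ 2)
      = Rad * (π * ((if m = 0 then (1:ℝ) else 0) + 1) * I) := by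
  have hS : MeasurableSet (sphRho ⁻¹' D) := sphRho_measurable hD
  have hpos : ∀ᵐ x : E3, 0 < sphRho x := by
    filter_upwards [Measure.ae_ne volume (0 : E3)] with x hx
    rw [sphRho_norm]; positivity
  have e1 : ∫ x in sphRho ⁻¹' D, ((Xmon n m sgn x).imI ^ 2 + (Xmon n m sgn x).imJ ^ 2)
      = ∫ x in sphRho ⁻¹' D, gradF n m sgn x := by
    apply integral_congr_ae
    filter_upwards [ae_restrict_of_ae hpos] with x hx using gradF_eq n m sgn x hx
  rw [e1, integral_eq_lintegral_of_nonneg_ae _ (gradF_measurable n m sgn).aestronglyMeasurable]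
  · rw [← lintegral_indicator hS, sph_lintegral _ (((gradF_measurable n m sgn).ennreal_ofReal).indicator hS)]
    have e2 : ∀ φ ∈ Set.Ioo (-π) π, (∫⁻ r in Set.Ioi (0:ℝ), ∫⁻ θ in Set.Ioo 0 π,
      ENNReal.ofReal (r ^ 2 * sin θ) *
        (sphRho ⁻¹' D).indicator (fun x => ENNReal.ofReal (gradF n m sgn x)) !₂[r * cos θ, r * sin θ * cos φ, r * sin θ * sin φ])
        = ENNReal.ofReal Rad * ENNReal.ofReal (legL (angG n m sgn φ)) := by
      intro φ hφ
      rw [← hR, ← lintegral_mul_const']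
      · refine setLIntegral_congr_fun measurableSet_Ioi fun r hr => ?_
        have hr : 0 < r := hr
        rw [← lint_theta n m sgn φ hφ, ← lintegral_const_mul']
        · refine setLIntegral_congr_fun measurableSet_Ioo fun θ hθ => ?_
          have hs := sin_pos_of_mem_Ioo hθ
          by_cases hrD : r ∈ D
          · rw [Set.indicator_of_mem hrD, Set.indicator_of_mem (by rw [Set.mem_preimage, sph_rho _ _ _ hr]; exact hrD),
              gradF_sph n m sgn r θ φ hr hθ hφ, ← ENNReal.ofReal_mul (by positivity), ← ENNReal.ofReal_mul (by positivity)]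
            congr 1
            rw [zpow_add₀ hr.ne']
            norm_cast
            ring
          · rw [Set.indicator_of_notMem hrD, Set.indicator_of_notMem (by rw [Set.mem_preimage, sph_rho _ _ _ hr]; exact hrD)]
            simp
        · by_cases hrD : r ∈ D <;> simp [hrD]
      · exact ENNReal.ofReal_ne_top
    rw [setLIntegral_congr_fun measurableSet_Ioo e2, lintegral_const_mul' _ _ ENNReal.ofReal_ne_top,
      lint_phi n m sgn h0, ← hI, ← ENNReal.ofReal_mul hR0, ENNReal.toReal_ofReal]
    have := pi_pos
    split_ifs <;> positivity
  · filter_upwards [ae_restrict_of_ae hpos] with x hx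
    rw [← gradF_eq n m sgn x hx, Pi.zero_apply]
    positivity


theorem rad_int (nn : ℕ) :
    ∫⁻ r in Set.Ioi (0:ℝ), (Set.Iio (1:ℝ)).indicator
      (fun r : ℝ => ENNReal.ofReal (r ^ (2 * (nn:ℤ) + 2))) r = ENNReal.ofReal (1 / (2 * (nn:ℝ) + 3)) := by
  rw [setLIntegral_indicator measurableSet_Iio, Set.inter_comm, Set.Ioi_inter_Iio]
  have e : ∀ r : ℝ, r ^ (2 * (nn:ℤ) + 2) = r ^ (2 * nn + 2) := fun r => by
    rw [← zpow_natCast]; norm_cast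
  simp only [e]
  rw [← ofReal_integral_eq_lintegral_ofReal, ← integral_Ioc_eq_integral_Ioo,
    ← intervalIntegral.integral_of_le zero_le_one, integral_pow]
  · congr 1; push_cast; simp; ring
  · have hc : Continuous (fun r : ℝ => r ^ (2 * nn + 2)) := by fun_prop
    exact (hc.integrableOn_Icc).mono_set Set.Ioo_subset_Icc_self
  · rw [Filter.EventuallyLE, ae_restrict_iff' measurableSet_Ioo]
    exact Filter.Eventually.of_forall fun r hr => pow_nonneg hr.1.le _

theorem rad_ext (k : ℕ) :
    ∫⁻ r in Set.Ioi (0:ℝ), (Set.Ioi (1:ℝ)).indicator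
      (fun r : ℝ => ENNReal.ofReal (r ^ (2 * (-(k:ℤ) - 2) + 2))) r = ENNReal.ofReal (1 / (2 * (k:ℝ) + 1)) := by
  rw [setLIntegral_indicator measurableSet_Ioi, Set.inter_eq_left.2 (Set.Ioi_subset_Ioi zero_le_one)]
  have hk : (0:ℝ) ≤ k := Nat.cast_nonneg k
  have e : ∀ r : ℝ, r ^ (2 * (-(k:ℤ) - 2) + 2) = r ^ (-2 * (k:ℝ) - 2) := fun r => by
    rw [← rpow_intCast]; congr 1; push_cast; ring
  simp only [e]
  have hlt : -2 * (k:ℝ) - 2 < -1 := by linarith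
  rw [← ofReal_integral_eq_lintegral_ofReal, integral_Ioi_rpow_of_lt hlt one_pos]
  · congr 1; rw [one_rpow]
    have h1 : -2 * (k:ℝ) - 2 + 1 = -(2 * k + 1) := by ring
    rw [h1, neg_div_neg_eq]
  · exact integrableOn_Ioi_rpow_of_lt hlt one_pos
  · rw [Filter.EventuallyLE, ae_restrict_iff' measurableSet_Ioi]
    exact Filter.Eventually.of_forall fun r hr => rpow_nonneg (zero_le_one.trans (le_of_lt hr)) _


/-- squared `L²` norm of `Vec X_{n,m}^{±}` over the unit ball
(`n ≥ 0`) resp. its exterior (`n ≤ -2`):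
`‖Vec X_{n,m}^{±}‖² = 2π(n²+m²+n)(δ_{0,m}+1)(|n+3/2|+m−1/2)! /
((2n+3)(2n+1)(|n+3/2|−m−1/2)!)`, where `|n+3/2|±(m... )` equals `n+m+1`, `n-m+1`
in the interior case and `-n-2+m`, `-n-2-m` in the exterior case. -/
theorem stmt14 (n : ℤ) (m : ℕ) (sgn : Bool) (h0 : m = 0 → sgn = true)
    (h : (0 ≤ n ∧ (m : ℤ) ≤ n + 1) ∨ (n ≤ -2 ∧ (m : ℤ) ≤ -n - 2)) :
    ∫ x in (if 0 ≤ n then Metric.ball (0 : E3) 1 else extB),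
        ((Xmon n m sgn x).imI ^ 2 + (Xmon n m sgn x).imJ ^ 2) =
      2 * π * ((n ^ 2 + (m : ℤ) ^ 2 + n : ℤ) : ℝ) * ((if m = 0 then (1 : ℝ) else 0) + 1) *
        (((if 0 ≤ n then n + (m : ℤ) + 1 else -n - 2 + (m : ℤ)).toNat.factorial : ℝ)) /
        ((((2 * n + 3) * (2 * n + 1) : ℤ) : ℝ) *
          ((if 0 ≤ n then n - (m : ℤ) + 1 else -n - 2 - (m : ℤ)).toNat.factorial : ℝ)) := by
  rcases h with ⟨hn, hm⟩ | ⟨hn, hm⟩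
  · obtain ⟨nn, rfl⟩ := Int.eq_ofNat_of_zero_le hn
    simp only [if_pos hn]
    have hball : Metric.ball (0 : E3) 1 = sphRho ⁻¹' Set.Iio 1 := by
      ext x; rw [mem_ball_zero_iff, Set.mem_preimage, sphRho_norm, Set.mem_Iio]
    have hmk : m ≤ nn + 1 := by omega
    have hdeg : legDeg ((nn:ℤ) + 1) = nn + 1 := by
      unfold legDeg; rw [if_pos (by omega)]; omega
    have hA := legA_eq (nn + 1) m hmk
    have hI := legI_int (nn + 1) m
    have hf1 : (0:ℝ) < ((nn + 1 - m).factorial : ℝ) := by exact_mod_cast Nat.factorial_pos _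
    have hval : legL (legInt (legDeg ((nn:ℤ) + 1)) m (((nn:ℤ) + 1 - m : ℤ) : ℝ)
        + 2 * (legV m * legQ (legDeg ((nn:ℤ) + 1)) m ^ 2))
        = 2 * ((nn:ℝ) ^ 2 + nn + m ^ 2) * (nn + 1 + m).factorial / ((2 * nn + 1) * (nn + 1 - m).factorial) := by
      rw [hdeg]
      rw [hA] at hI
      have e : (((nn:ℤ) + 1 - m : ℤ) : ℝ) = ((nn + 1 : ℕ) : ℝ) - m := by push_cast; ring
      rw [e]
      have h1 : (0:ℝ) < 2 * ((nn + 1 : ℕ) : ℝ) - 1 := by push_cast; linarith [(Nat.cast_nonneg nn : (0:ℝ) ≤ nn)]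
      apply mul_left_cancel₀ h1.ne'
      rw [hI]
      push_cast
      have h2 : (0:ℝ) < 2 * (nn + 1) + 1 := by positivity
      have h3 : (2 * ((nn:ℝ) + 1) - 1) = 2 * nn + 1 := by ring
      rw [h3]
      field_simp
      ring
    have := main_int nn m sgn h0 (Set.Iio 1) measurableSet_Iio (1 / (2 * (nn:ℝ) + 3)) (by positivity)
      (rad_int nn) _ rfl (by rw [hval]; positivity)
    rw [hball, this, hval]
    have t1 : ((nn:ℤ) + m + 1).toNat = nn + 1 + m := by omega
    have t2 : ((nn:ℤ) - m + 1).toNat = nn + 1 - m := by omega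
    rw [t1, t2]
    push_cast
    field_simp
    ring
  · obtain ⟨k, hk⟩ := Int.eq_ofNat_of_zero_le (show 0 ≤ -n - 2 by omega)
    obtain rfl : n = -(k:ℤ) - 2 := by omega
    have hn' : ¬ (0 ≤ -(k:ℤ) - 2) := by omega
    simp only [if_neg hn']
    have hball : extB = sphRho ⁻¹' Set.Ioi 1 := by
      ext x; rw [extB, Set.mem_setOf_eq, Set.mem_preimage, sphRho_norm, Set.mem_Ioi]
    have hmk : m ≤ k := by omega
    have hdeg : legDeg (-(k:ℤ) - 2 + 1) = k := by
      unfold legDeg; rw [if_neg (by omega)]; omega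
    have hA := legA_eq k m hmk
    have hI := legI_ext k m
    have hf1 : (0:ℝ) < ((k - m).factorial : ℝ) := by exact_mod_cast Nat.factorial_pos _
    have hval : legL (legInt (legDeg (-(k:ℤ) - 2 + 1)) m ((-(k:ℤ) - 2 + 1 - m : ℤ) : ℝ)
        + 2 * (legV m * legQ (legDeg (-(k:ℤ) - 2 + 1)) m ^ 2))
        = 2 * (((k:ℝ) + 1) * (k + 2) + m ^ 2) * (k + m).factorial / ((2 * k + 3) * (k - m).factorial) := by
      rw [hdeg]
      rw [hA] at hI
      have e : ((-(k:ℤ) - 2 + 1 - m : ℤ) : ℝ) = -(k:ℝ) - 1 - m := by push_cast; ring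
      rw [e]
      have h1 : (0:ℝ) < 2 * (k : ℝ) + 3 := by positivity
      apply mul_left_cancel₀ h1.ne'
      rw [hI]
      field_simp
    have := main_int (-(k:ℤ) - 2) m sgn h0 (Set.Ioi 1) measurableSet_Ioi (1 / (2 * (k:ℝ) + 1)) (by positivity)
      (rad_ext k) _ rfl (by rw [hval]; positivity)
    rw [hball, this, hval]
    have t1 : (-(-(k:ℤ) - 2) - 2 + m).toNat = k + m := by omega
    have t2 : (-(-(k:ℤ) - 2) - 2 - m).toNat = k - m := by omega
    rw [t1, t2]
    push_cast
    have e1 : (2 * (-(k:ℝ) - 2) + 3) * (2 * (-(k:ℝ) - 2) + 1) = (2 * k + 1) * (2 * k + 3) := by ring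
    have e2 : ((-(k:ℝ) - 2) ^ 2 + (m:ℝ) ^ 2 + (-(k:ℝ) - 2)) = (k + 1) * (k + 2) + m ^ 2 := by ring
    rw [e1, e2]
    field_simp

end
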